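/- Let q = 2m + 1 with m ≥ 1 an integer, and let the design space Ω be the set of all nonzero vectors in {0,1}^q. Let p_odd be the design measure assigning mass n_{m+1}⁻¹, where n_{m+1} = C(q,m+1), to each design point with exactly m+1 ones and mass 0 to every other design point. Then for t ∈ [0,1), p_odd is D-optimal (H(p_odd) is invertible and det H(p_odd) ≥ det H(p) for every design measure p on Ω with H(p) invertible) if and only if 0 ≤ t ≤ q/(q+1). -/

import Mathlib

open Matrix BigOperators Finset

noncomputable section

/-- The binary design point (0/1 vector) with support `S`. -/
def ind {q : ℕ} (S : Finset (Fin q)) : Fin q → ℝ := fun i => if i ∈ S then 1 else 0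

/-- A design measure on the nonzero binary vectors of length `q`, indexed by
their supports: nonnegative masses summing to 1, with zero mass on the zero vector. -/
def designMeasureB {q : ℕ} (p : Finset (Fin q) → ℝ) : Prop :=
  p ∅ = 0 ∧ (∀ S, 0 ≤ p S) ∧ ∑ S : Finset (Fin q), p S = 1

/-- G(p) = Σ p_x x xᵀ. -/
def GmatB {q : ℕ} (p : Finset (Fin q) → ℝ) : Matrix (Fin q) (Fin q) ℝ :=
  ∑ S : Finset (Fin q), p S • Matrix.vecMulVec (ind S) (ind S)

/-- g(p) = Σ p_x x. -/
def gvecB {q : ℕ} (p : Finset (Fin q) → ℝ) : Fin q → ℝ :=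
  ∑ S : Finset (Fin q), p S • ind S

/-- H(p) = G(p) − t g(p) g(p)ᵀ. -/
def HmatB {q : ℕ} (t : ℝ) (p : Finset (Fin q) → ℝ) : Matrix (Fin q) (Fin q) ℝ :=
  GmatB p - t • Matrix.vecMulVec (gvecB p) (gvecB p)

/-- The all-ones q×q matrix J_q. -/
def Jmat (q : ℕ) : Matrix (Fin q) (Fin q) ℝ := Matrix.of fun _ _ => 1

end
lemma H_apply {q : ℕ} (t : ℝ) (p : Finset (Fin q) → ℝ) (i j : Fin q) :
    HmatB t p i j = ∑ S, p S * (ind S i * ind S j)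
      - t * ((∑ S, p S * ind S i) * (∑ S, p S * ind S j)) := by
  simp [HmatB, GmatB, gvecB, Matrix.sum_apply, Matrix.vecMulVec_apply, Finset.sum_apply]

lemma amgm {q : ℕ} (hq : 0 < q) (z : Fin q → ℝ) (hz : ∀ i, 0 ≤ z i) :
    ∏ i, z i ≤ ((∑ i, z i) / q) ^ q := by
  have hq' : (0:ℝ) < q := by exact_mod_cast hq
  have h := Real.geom_mean_le_arith_mean Finset.univ (fun _ => (1:ℝ)) z (by simp)
    (by simpa using hq) (fun i _ => hz i)
  simp only [Real.rpow_one, one_mul, Finset.sum_const, Finset.card_univ, Fintype.card_fin,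
    nsmul_eq_mul, mul_one] at h
  have hp : 0 ≤ ∏ i, z i := Finset.prod_nonneg fun i _ => hz i
  calc ∏ i, z i = ((∏ i, z i) ^ ((q:ℝ)⁻¹)) ^ q := by
        rw [Real.rpow_inv_natCast_pow hp hq.ne']
    _ ≤ _ := by gcongr

lemma det_le_trace {q : ℕ} (hq : 0 < q) (A : Matrix (Fin q) (Fin q) ℝ) (hA : A.PosSemidef) :
    A.det ≤ (A.trace / q) ^ q := by
  rw [hA.isHermitian.det_eq_prod_eigenvalues, hA.isHermitian.trace_eq_sum_eigenvalues]
  exact amgm hq _ (fun i => hA.eigenvalues_nonneg i)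

lemma det_J (q : ℕ) (A B : ℝ) (hA : A ≠ 0) :
    (A • (1 : Matrix (Fin q) (Fin q) ℝ) + B • Jmat q).det = A ^ q * (1 + q * (B / A)) := by
  have : A • (1 : Matrix (Fin q) (Fin q) ℝ) + B • Jmat q
      = A • ((1 : Matrix (Fin q) (Fin q) ℝ) + replicateCol Unit (fun _ : Fin q => B / A) * replicateRow Unit (fun _ : Fin q => (1:ℝ))) := by
    ext i j
    simp [Jmat, Matrix.mul_apply, mul_add]
    field_simp
  rw [this, Matrix.det_smul, Matrix.det_one_add_replicateCol_mul_replicateRow]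
  simp [dotProduct]

lemma H_psd {q : ℕ} (t : ℝ) (ht0 : 0 ≤ t) (ht1 : t < 1) (p : Finset (Fin q) → ℝ)
    (hp : designMeasureB p) : (HmatB t p).PosSemidef := by
  obtain ⟨h0, hn, h1⟩ := hp
  refine Matrix.PosSemidef.of_dotProduct_mulVec_nonneg ?_ ?_
  · ext i j
    simp only [Matrix.conjTranspose_apply, H_apply, star_trivial]
    congr 1
    · exact Finset.sum_congr rfl fun S _ => by ring
    · ring
  · intro x
    have e : star x ⬝ᵥ (HmatB t p *ᵥ x)
        = ∑ S, p S * (∑ i, ind S i * x i) ^ 2 - t * (∑ S, p S * (∑ i, ind S i * x i)) ^ 2 := by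
      simp only [HmatB, GmatB, gvecB, Matrix.sub_mulVec, dotProduct_sub, Matrix.sum_mulVec,
        dotProduct_sum, Matrix.smul_mulVec, dotProduct_smul, Matrix.vecMulVec_mulVec, star_trivial,
        smul_eq_mul, sum_dotProduct, smul_dotProduct]
      have c : ∀ S : Finset (Fin q), x ⬝ᵥ ind S = ind S ⬝ᵥ x := fun S => dotProduct_comm _ _
      simp only [MulOpposite.smul_eq_mul_unop, MulOpposite.unop_op, c, op_smul_eq_smul, dotProduct_smul, smul_eq_mul, dotProduct_sum]
      have d : ∀ S : Finset (Fin q), ind S ⬝ᵥ x = ∑ i, ind S i * x i := fun S => rfl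
      simp only [d]
      congr 1
      · exact Finset.sum_congr rfl fun S _ => by ring
      · ring
    rw [e]
    set y : Finset (Fin q) → ℝ := fun S => ∑ i, ind S i * x i with hy
    change 0 ≤ ∑ S, p S * y S ^ 2 - t * (∑ S, p S * y S) ^ 2
    set μ := ∑ S, p S * y S with hμ
    have v : 0 ≤ ∑ S, p S * (y S - μ) ^ 2 :=
      Finset.sum_nonneg fun S _ => mul_nonneg (hn S) (sq_nonneg _)
    have v2 : ∑ S, p S * (y S - μ) ^ 2 = ∑ S, p S * y S ^ 2 - μ ^ 2 := by
      have : ∀ S, p S * (y S - μ) ^ 2 = p S * y S ^ 2 - 2 * μ * (p S * y S) + μ ^ 2 * p S :=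
        fun S => by ring
      simp only [this, Finset.sum_add_distrib, Finset.sum_sub_distrib, ← Finset.mul_sum]
      rw [← hμ, h1]; ring
    nlinarith [sq_nonneg μ]

lemma ind_sum {q : ℕ} (S : Finset (Fin q)) : ∑ i, ind S i = (S.card : ℝ) := by
  simp [ind]

lemma key_bound {q : ℕ} (hq : 0 < q) (t : ℝ) (ht0 : 0 ≤ t) (ht1 : t < 1)
    (p : Finset (Fin q) → ℝ) (hp : designMeasureB p) (d : ℝ) (hd : 0 ≤ 1 - q * d) :
    0 ≤ (HmatB t p).trace - d * ∑ i, ∑ j, HmatB t p i j ∧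
    (1 - q * d) * (HmatB t p).det ≤
      (((HmatB t p).trace - d * ∑ i, ∑ j, HmatB t p i j) / q) ^ q := by
  have hq' : (0:ℝ) < q := by exact_mod_cast hq
  set w := √(1 - q * d) with hw
  have hw2 : w ^ 2 = 1 - q * d := Real.sq_sqrt hd
  set R : Matrix (Fin q) (Fin q) ℝ := (1:ℝ) • 1 + (-((1 - w) / q)) • Jmat q with hR
  have hRt : Rᴴ = R := by
    ext i j
    simp [hR, Jmat, Matrix.one_apply, eq_comm]
  have hdet : R.det = w := by
    rw [hR, det_J _ _ _ one_ne_zero]; field_simp; simp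
  have hpsd := (H_psd t ht0 ht1 p hp).mul_mul_conjTranspose_same R
  have h := det_le_trace hq _ hpsd
  have htr := hpsd.trace_nonneg
  have hRR : R * R = 1 - d • Jmat q := by
    have hJ : Jmat q * Jmat q = (q:ℝ) • Jmat q := by
      ext i j; simp [Jmat, Matrix.mul_apply]
    simp only [hR, add_mul, mul_add, Matrix.smul_mul, Matrix.mul_smul, hJ, one_mul, mul_one, one_smul]
    ext i j
    simp only [Matrix.add_apply, Matrix.sub_apply, Matrix.smul_apply, Jmat, Matrix.of_apply, smul_eq_mul]
    have : d = (1 - w^2)/q := by rw [hw2]; field_simp; ring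
    rw [this]; field_simp; ring
  rw [hRt, Matrix.det_mul, Matrix.det_mul, hdet, Matrix.trace_mul_comm, ← mul_assoc, hRR] at h
  rw [hRt, Matrix.trace_mul_comm, ← mul_assoc, hRR] at htr
  rw [← hw2]
  have e : ((1 - d • Jmat q) * HmatB t p).trace = (HmatB t p).trace - d * ∑ i, ∑ j, HmatB t p i j := by
    rw [sub_mul, Matrix.trace_sub, one_mul, Matrix.smul_mul, Matrix.trace_smul,
      Finset.sum_comm (f := fun i j => HmatB t p i j)]
    simp [Matrix.trace, Matrix.mul_apply, Jmat]
  rw [e] at h htr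
  refine ⟨htr, ?_⟩
  calc _ = w * (HmatB t p).det * w := by ring
    _ ≤ _ := h

lemma trace_H {q : ℕ} (hq : 0 < q) (t : ℝ) (ht0 : 0 ≤ t) (p : Finset (Fin q) → ℝ) :
    (HmatB t p).trace ≤ ∑ S, p S * (S.card : ℝ) - t * (∑ S, p S * (S.card : ℝ)) ^ 2 / q := by
  have hq' : (0:ℝ) < q := by exact_mod_cast hq
  have e1 : ∑ i, ∑ S, p S * ind S i = ∑ S, p S * (S.card : ℝ) := by
    rw [Finset.sum_comm]; simp only [← Finset.mul_sum, ind_sum]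
  have e2 : (HmatB t p).trace = ∑ S, p S * (S.card : ℝ) - t * ∑ i, (∑ S, p S * ind S i) ^ 2 := by
    have : ∀ S : Finset (Fin q), ∀ i, ind S i * ind S i = ind S i := fun S i => by simp [ind]
    simp only [Matrix.trace, Matrix.diag, H_apply, Finset.sum_sub_distrib, this, e1, ← Finset.mul_sum, sq]
  have c := sq_sum_le_card_mul_sum_sq (s := Finset.univ) (f := fun i : Fin q => ∑ S, p S * ind S i)
  rw [e1] at c
  simp only [Finset.card_univ, Fintype.card_fin] at c
  rw [e2, mul_div_assoc]
  have : (∑ S, p S * (S.card : ℝ)) ^ 2 / q ≤ ∑ i, (∑ S, p S * ind S i) ^ 2 := by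
    rw [div_le_iff₀ hq']; linarith
  nlinarith

lemma sum_H {q : ℕ} (t : ℝ) (p : Finset (Fin q) → ℝ) :
    ∑ i, ∑ j, HmatB t p i j = ∑ S, p S * (S.card : ℝ) ^ 2 - t * (∑ S, p S * (S.card : ℝ)) ^ 2 := by
  have e1 : ∑ i, ∑ S, p S * ind S i = ∑ S, p S * (S.card : ℝ) := by
    rw [Finset.sum_comm]; simp only [← Finset.mul_sum, ind_sum]
  simp only [H_apply, Finset.sum_sub_distrib, ← Finset.mul_sum, ← Finset.sum_mul, e1]
  congr 1
  · have : ∀ i : Fin q, ∑ j, ∑ S, p S * (ind S i * ind S j) = ∑ S, p S * (ind S i * S.card) := by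
      intro i; rw [Finset.sum_comm]; simp only [← Finset.mul_sum, ind_sum]
    simp only [this]
    rw [Finset.sum_comm]; simp only [← Finset.mul_sum, ← Finset.sum_mul, ind_sum, sq]
  · ring

lemma G_odd (m : ℕ) (hm : 1 ≤ m) (i j : Fin (2*m+1)) :
    ∑ S : Finset (Fin (2*m+1)),
      (if S.card = m + 1 then ((Nat.choose (2*m+1) (m+1) : ℝ))⁻¹ else 0) * (ind S i * ind S j)
    = (m+1) / (2*m+1) * (if i = j then 1 else 1/2) := by
  have e : ∀ S : Finset (Fin (2*m+1)),
      (if S.card = m + 1 then ((Nat.choose (2*m+1) (m+1) : ℝ))⁻¹ else 0) * (ind S i * ind S j)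
      = if (S ∈ Finset.powersetCard (m+1) Finset.univ ∧ {i,j} ⊆ S) then ((Nat.choose (2*m+1) (m+1) : ℝ))⁻¹ else 0 := by
    intro S
    by_cases h1 : S.card = m + 1 <;> by_cases h2 : i ∈ S <;> by_cases h3 : j ∈ S <;>
      simp [ind, h1, h2, h3, Finset.insert_subset_iff]
  simp only [e]
  rw [← Finset.sum_filter, Finset.sum_const, nsmul_eq_mul]
  have hC : (0:ℝ) < Nat.choose (2*m+1) (m+1) := by exact_mod_cast Nat.choose_pos (by omega)
  have s1 : ((2*m+1 : ℕ):ℝ) * Nat.choose (2*m) m = Nat.choose (2*m+1) (m+1) * (m+1) := by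
    exact_mod_cast Nat.add_one_mul_choose_eq (2*m) m
  have hf : (Finset.univ.filter fun S : Finset (Fin (2*m+1)) => S ∈ Finset.powersetCard (m+1) Finset.univ ∧ {i,j} ⊆ S)
     = (Finset.powersetCard (m+1) Finset.univ).filter fun S => {i,j} ⊆ S := by
    ext S; simp
  rw [hf]
  by_cases hij : i = j
  · subst hij
    rw [Finset.card_filter_powersetCard_subset _ _ _ (Finset.subset_univ _) (by simp)]
    simp only [Finset.card_univ, Fintype.card_fin, Finset.pair_eq_singleton, Finset.card_singleton,
      Nat.add_sub_cancel, if_true]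
    push_cast at s1
    field_simp
    linarith
  · have h2 : ({i, j} : Finset (Fin (2*m+1))).card = 2 := Finset.card_pair hij
    rw [Finset.card_filter_powersetCard_subset _ _ _ (Finset.subset_univ _) (by omega)]
    rw [h2, if_neg hij]
    simp only [Finset.card_univ, Fintype.card_fin]
    obtain ⟨k, rfl⟩ : ∃ k, m = k + 1 := ⟨m - 1, by omega⟩
    have s2 : ((2*k+2 : ℕ):ℝ) * Nat.choose (2*k+1) k = Nat.choose (2*(k+1)) (k+1) * (k+1) := by
      exact_mod_cast Nat.add_one_mul_choose_eq (2*k+1) k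
    have e3 : 2 * (k+1) + 1 - 2 = 2*k+1 := by omega
    have e4 : k + 1 + 1 - 2 = k := by omega
    rw [e3, e4]
    push_cast at s1 s2 ⊢
    have hk : (0:ℝ) < k + 1 := by positivity
    have s3 : 2 * (Nat.choose (2*k+1) k : ℝ) = Nat.choose (2*(k+1)) (k+1) := by
      apply mul_right_cancel₀ hk.ne'
      linarith
    rw [← s3] at s1
    field_simp
    linarith

/-- Mixture of the optimal odd design with the full point. -/
noncomputable def pmix (m : ℕ) (ε : ℝ) : Finset (Fin (2*m+1)) → ℝ := fun S =>
  (1 - ε) * (if S.card = m + 1 then ((Nat.choose (2*m+1) (m+1) : ℝ))⁻¹ else 0)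
    + (if S = Finset.univ then ε else 0)

lemma pmix_design (m : ℕ) (ε : ℝ) (h0 : 0 ≤ ε) (h1 : ε ≤ 1) : designMeasureB (pmix m ε) := by
  have hC : (0:ℝ) < Nat.choose (2*m+1) (m+1) := by exact_mod_cast Nat.choose_pos (by omega)
  refine ⟨?_, ?_, ?_⟩
  · have : (∅ : Finset (Fin (2*m+1))) ≠ Finset.univ := by
      intro h
      have := congrArg Finset.card h
      simp at this
    simp [pmix, this]
  · intro S
    have : 0 ≤ 1 - ε := by linarith
    unfold pmix
    split_ifs <;> positivity
  · simp only [pmix, Finset.sum_add_distrib, ← Finset.mul_sum]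
    rw [← Finset.sum_filter]
    have : (Finset.univ.filter fun S : Finset (Fin (2*m+1)) => S.card = m+1).card
        = Nat.choose (2*m+1) (m+1) := by
      simp
    rw [Finset.sum_const, this, nsmul_eq_mul, mul_inv_cancel₀ hC.ne']
    simp

lemma H_mix (m : ℕ) (hm : 1 ≤ m) (t ε : ℝ) :
    HmatB t (pmix m ε) = ((1 - ε) * ((m+1) / (2*m+1) / 2)) • (1 : Matrix (Fin (2*m+1)) (Fin (2*m+1)) ℝ)
      + ((1 - ε) * ((m+1) / (2*m+1) / 2) + ε - t * ((1 - ε) * ((m+1) / (2*m+1)) + ε) ^ 2) • Jmat (2*m+1) := by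
  have hg : ∀ i, ∑ S, pmix m ε S * ind S i = (1 - ε) * ((m+1) / (2*m+1)) + ε := by
    intro i
    have := G_odd m hm i i
    have e : ∀ S : Finset (Fin (2*m+1)), ∀ i, ind S i * ind S i = ind S i := fun S i => by simp [ind]
    simp only [e, if_true, mul_one] at this
    simp only [pmix, add_mul, Finset.sum_add_distrib, mul_assoc, ← Finset.mul_sum, this]
    simp only [ite_mul, zero_mul, Finset.sum_ite_eq', Finset.mem_univ, if_true, ind, mul_one]
  ext i j
  rw [H_apply, hg, hg]
  simp only [pmix, add_mul, Finset.sum_add_distrib, mul_assoc, ← Finset.mul_sum, G_odd m hm i j]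
  simp only [ite_mul, zero_mul, Finset.sum_ite_eq', Finset.mem_univ, if_true, ind, mul_one]
  by_cases hij : i = j
  · subst hij; simp [Jmat]; ring
  · simp [Jmat, hij]; ring

lemma det_mix (m : ℕ) (hm : 1 ≤ m) (t ε : ℝ) (hε : ε < 1) :
    (HmatB t (pmix m ε)).det = ((m+1) / (2*m+1) / 2) ^ (2*m) * ((1 - ε) ^ (2*m) *
      ((m+1)^2/(2*m+1) * (1 - t)
        + (-((m+1)^2/(2*m+1)) + (2*m+1) - 2 * t * (m+1) * m / (2*m+1)) * ε
        + (- t * m^2 / (2*m+1)) * ε ^ 2)) := by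
  have hε' : 0 < 1 - ε := by linarith
  have hA : (1 - ε) * (((m:ℝ)+1) / (2*m+1) / 2) ≠ 0 := by positivity
  rw [H_mix m hm, det_J _ _ _ hA, pow_succ, mul_assoc, ← mul_assoc _ ((1-ε)^(2*m)), mul_pow, mul_comm ((1-ε)^(2*m))]
  congr 1
  rw [mul_add, mul_one, mul_left_comm, mul_div_cancel₀ _ hA]
  push_cast
  field_simp
  ring

lemma upper (m : ℕ) (t : ℝ) (ht0 : 0 ≤ t) (ht1 : t < 1)
    (ht : t ≤ (2*m+1 : ℝ) / ((2*m+1 : ℝ) + 1)) (p : Finset (Fin (2*m+1)) → ℝ)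
    (hp : designMeasureB p) :
    (HmatB t p).det ≤ (((m:ℝ)+1) / (2*m+1) / 2) ^ (2*m+1) * ((2*m+2) * (1 - t)) := by
  have hs : 0 < 1 - t := by linarith
  have hκ : 0 ≤ (2*m+1 : ℝ) - t * (2*m+2) := by
    rw [le_div_iff₀ (by positivity)] at ht; linarith
  set d : ℝ := ((2*m+1) - t * (2*m+2)) / ((2*m+1) * ((2*m+2) * (1 - t))) with hd
  have hd1 : 1 - ((2*m+1 : ℕ) : ℝ) * d = 1 / ((2*m+2) * (1 - t)) := by
    rw [hd]; push_cast; field_simp; ring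
  obtain ⟨hT0, hb⟩ := key_bound (by omega) t ht0 ht1 p hp d (by rw [hd1]; positivity)
  have htr := trace_H (by omega) t ht0 p
  rw [sum_H] at hT0 hb
  rw [hd1] at hb
  obtain ⟨-, hn, h1⟩ := hp
  set E1 := ∑ S, p S * (S.card : ℝ) with hE1
  set E2 := ∑ S, p S * (S.card : ℝ) ^ 2 with hE2
  have hvar : 0 ≤ E2 - 2 * (m+1) * E1 + (m+1)^2 := by
    have v : 0 ≤ ∑ S, p S * ((S.card : ℝ) - (m+1)) ^ 2 :=
      Finset.sum_nonneg fun S _ => mul_nonneg (hn S) (sq_nonneg _)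
    have : ∀ S, p S * ((S.card : ℝ) - (m+1)) ^ 2
        = p S * (S.card : ℝ) ^ 2 - 2 * (m+1) * (p S * (S.card : ℝ)) + (m+1)^2 * p S :=
      fun S => by ring
    simp only [this, Finset.sum_add_distrib, Finset.sum_sub_distrib, ← Finset.mul_sum] at v
    rw [h1] at v
    linarith
  have hT : (HmatB t p).trace - d * (E2 - t * E1 ^ 2) ≤ ((m:ℝ)+1) / 2 := by
    refine le_trans (sub_le_sub_right htr _) ?_
    have e : (m + 1 : ℝ) / 2 - (E1 - t * E1 ^ 2 / ((2*m+1 : ℕ) : ℝ) - d * (E2 - t * E1 ^ 2))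
        = (((2*m+1) - t * (2*m+2)) * (E2 - 2 * (m+1) * E1 + (m+1)^2) + t * (E1 - (m+1)) ^ 2)
          / ((2*m+1) * ((2*m+2) * (1 - t))) := by
      rw [hd]; push_cast; field_simp; ring
    have : 0 ≤ (((2*m+1) - t * (2*m+2)) * (E2 - 2 * (m+1) * E1 + (m+1)^2) + t * (E1 - (m+1)) ^ 2)
          / ((2*m+1) * ((2*m+2) * (1 - t))) := by positivity
    linarith
  have hW : 0 < (2*m+2) * (1 - t) := by positivity
  have hb2 : 1 / ((2*m+2) * (1 - t)) * (HmatB t p).det ≤ (((m:ℝ)+1) / (2*m+1) / 2) ^ (2*m+1) := by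
    refine hb.trans (pow_le_pow_left₀ (by positivity) ?_ _)
    calc _ ≤ (((m:ℝ)+1) / 2) / ((2*m+1 : ℕ) : ℝ) := by gcongr
      _ = _ := by push_cast; field_simp
  rw [one_div, inv_mul_le_iff₀ hW] at hb2
  linarith

theorem statement_14 (m : ℕ) (hm : 1 ≤ m) (t : ℝ) (ht0 : 0 ≤ t) (ht1 : t < 1) :
    (IsUnit (HmatB t (fun S : Finset (Fin (2*m+1)) =>
          if S.card = m + 1 then ((Nat.choose (2*m+1) (m+1) : ℝ))⁻¹ else 0)).det
      ∧ ∀ p : Finset (Fin (2*m+1)) → ℝ, designMeasureB p → IsUnit (HmatB t p).det →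
          (HmatB t p).det ≤ (HmatB t (fun S : Finset (Fin (2*m+1)) =>
            if S.card = m + 1 then ((Nat.choose (2*m+1) (m+1) : ℝ))⁻¹ else 0)).det)
    ↔ (0 ≤ t ∧ t ≤ (2*m+1 : ℝ) / ((2*m+1 : ℝ) + 1)) := by
  have hs : 0 < 1 - t := by linarith
  have e0 : (fun S : Finset (Fin (2*m+1)) =>
      if S.card = m + 1 then ((Nat.choose (2*m+1) (m+1) : ℝ))⁻¹ else 0) = pmix m 0 := by
    funext S; simp [pmix]
  rw [e0]
  have d0 := det_mix m hm t 0 one_pos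
  simp only [sub_zero, one_pow, one_mul, mul_zero, add_zero, ne_eq, OfNat.ofNat_ne_zero,
    not_false_eq_true, zero_pow] at d0
  have hm' : (1:ℝ) ≤ m := by exact_mod_cast hm
  constructor
  · rintro ⟨-, h⟩
    refine ⟨ht0, ?_⟩
    by_contra hlt
    rw [not_le, div_lt_iff₀ (by positivity)] at hlt
    set C : ℝ := (m+1)^2/(2*m+1) * (1 - t) with hC
    set D : ℝ := -((m+1)^2/(2*m+1)) + (2*m+1) - 2 * t * (m+1) * m / (2*m+1) with hD
    set E : ℝ := - t * m^2 / (2*m+1) with hE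
    have hCpos : 0 < C := by positivity
    have hE0 : E ≤ 0 := by
      have : 0 ≤ t * m^2 / (2*m+1) := by positivity
      have : E = - (t * m^2 / (2*m+1)) := by rw [hE]; ring
      linarith
    set η := D - 2 * m * C with hη
    have hηpos : 0 < η := by
      have : η = m^2 * (t * (2*m+1+1) - (2*m+1)) / (2*m+1) := by
        rw [hη, hD, hC]; field_simp; ring
      rw [this]
      have : 0 < t * (2*m+1+1) - (2*m+1) := by linarith
      positivity
    set K := |E - 2 * m * D| + 1 with hK
    have hKpos : 0 < K := by positivity
    set ε := η / (K + (2*m+1) * η) with hεd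
    have hε : 0 < ε := by positivity
    have hεe : ε * (K + (2*m+1) * η) = η := by
      rw [hεd]; field_simp
    have hε1 : 2 * m * ε < 1 := by
      rw [hεd, ← mul_div_assoc, div_lt_one (by positivity)]; nlinarith
    have hεK : ε * K < η := by
      have : 0 < ε * ((2*m+1) * η) := by positivity
      nlinarith
    have hεlt : ε < 1 := by nlinarith
    have hmain : C < (1 - 2 * m * ε) * (C + D * ε + E * ε ^ 2) := by
      have a1 : -(E - 2*m*D) ≤ |E - 2*m*D| := neg_le_abs _
      have a2 : 0 < η + ε * (E - 2*m*D) := by nlinarith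
      have a3 : 0 < ε * (η + ε * (E - 2*m*D)) := by positivity
      have a4 : 0 ≤ 2 * m * (-E) * ε ^ 3 := by
        have : 0 ≤ -E := by linarith
        positivity
      have : (1 - 2 * m * ε) * (C + D * ε + E * ε ^ 2)
          = C + ε * (η + ε * (E - 2*m*D)) + 2 * m * (-E) * ε ^ 3 := by
        rw [hη]; ring
      linarith
    have hF : 0 < C + D * ε + E * ε ^ 2 := by
      have : 0 < 1 - 2 * m * ε := by linarith
      exact pos_of_mul_pos_right (hCpos.trans hmain) this.le
    have hbern : 1 - 2 * m * ε ≤ (1 - ε) ^ (2*m) := by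
      have := one_add_mul_le_pow (a := -ε) (by linarith) (2*m)
      push_cast at this
      calc _ = 1 + 2 * m * (-ε) := by ring
        _ ≤ _ := this
        _ = _ := by rw [← sub_eq_add_neg]
    have hlt2 : C < (1 - ε) ^ (2*m) * (C + D * ε + E * ε ^ 2) :=
      hmain.trans_le (by gcongr)
    have hd := det_mix m hm t ε hεlt
    have hP : (0:ℝ) < ((m+1) / (2*m+1) / 2) ^ (2*m) := by positivity
    have hgt : (HmatB t (pmix m 0)).det < (HmatB t (pmix m ε)).det := by
      rw [d0, hd]
      exact mul_lt_mul_of_pos_left hlt2 hP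
    have hpos : 0 < (HmatB t (pmix m 0)).det := by rw [d0]; positivity
    exact absurd (h _ (pmix_design m ε hε.le hεlt.le) (isUnit_iff_ne_zero.2 (hpos.trans hgt).ne'))
      (not_le.2 hgt)
  · rintro ⟨-, ht⟩
    refine ⟨isUnit_iff_ne_zero.2 ?_, fun p hp _ => ?_⟩
    · rw [d0]; positivity
    · refine (upper m t ht0 ht1 ht p hp).trans (le_of_eq ?_)
      rw [d0, pow_succ, mul_assoc]
      congr 1
      field_simp
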